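/- arXiv:0811.2935 — 3 statements merged into one kernel-verified Lean document; each statement's English description precedes it below -/
import Mathlib

section
/- Let s be an integer, l ≥ |s|, and let f = Σ_{m=−l}^{l} c_m ₛY_{lm} with arbitrary coefficients c_m ∈ ℂ. Then lim_{θ→0⁺} e^{isφ} f(θ,φ) = ∫₀^π ∫_{−π}^{π} f(θ,φ) conj(ₛZ_l(θ,φ)) dφ sin θ dθ, where ₛZ_l = (−1)^{max(s,0)} √((2l+1)/(4π)) · ₛY_{l,−s}; the limit exists uniformly in φ and equals (−1)^{max(s,0)} √((2l+1)/(4π)) · c_{−s}. -/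
noncomputable section

/-- Integer binomial coefficient, zero outside `0 ≤ j ≤ n`. -/
def izbinom (n j : ℤ) : ℕ := if 0 ≤ j ∧ j ≤ n then n.toNat.choose j.toNat else 0

/-- The normalization constant `a_{lm} = √((l+m)!(l−m)!(2l+1)/(4π))`. -/
noncomputable def alm (l m : ℤ) : ℝ :=
  Real.sqrt ((((l + m).toNat.factorial : ℝ) * ((l - m).toNat.factorial : ℝ) * (2 * (l : ℝ) + 1)) /
    (4 * Real.pi))

/-- The spin-`s` spherical harmonic `ₛY_{lm}` in the standard chart, as a function of `(θ, φ)`. -/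
noncomputable def sY (s l m : ℤ) (x : ℝ × ℝ) : ℂ :=
  Complex.exp (Complex.I * (m : ℂ) * (x.2 : ℂ)) * (-1 : ℂ) ^ (max (-m) 0) *
    ((alm l m / Real.sqrt (((l + s).toNat.factorial : ℝ) * ((l - s).toNat.factorial : ℝ)) : ℝ) : ℂ) *
    ((Real.sin (x.1 / 2) : ℂ)) ^ (2 * l) *
    ∑ r ∈ Finset.Icc (0 : ℤ) (l - s),
      (izbinom (l - s) r : ℂ) * (izbinom (l + s) (r + s - m) : ℂ) * (-1 : ℂ) ^ (l - r - s) *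
        ((Real.cos (x.1 / 2) / Real.sin (x.1 / 2) : ℝ) : ℂ) ^ (2 * r + s - m)

/-- The spin-`s` zonal harmonic `ₛZ_l`. -/
noncomputable def sZ (s l : ℤ) (x : ℝ × ℝ) : ℂ :=
  (-1 : ℂ) ^ (max s 0) * (Real.sqrt ((2 * (l : ℝ) + 1) / (4 * Real.pi)) : ℂ) * sY s l (-s) x

open Finset in
theorem integral_pow_mul_one_sub_pow (a b : ℕ) :
    ∫ t in (0:ℝ)..1, t ^ a * (1 - t) ^ b = (a.factorial * b.factorial : ℝ) / (a + b + 1).factorial := by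
  induction a generalizing b with
  | zero =>
    have h := intervalIntegral.integral_comp_sub_left (fun t : ℝ => t ^ b) (a := 0) (b := 1) 1
    simp only [pow_zero, one_mul]
    rw [h]
    simp [Nat.factorial_succ]
    field_simp
  | succ a ih =>
    have hd : ∀ t : ℝ, HasDerivAt (fun t : ℝ => t ^ (a + 1) * (1 - t) ^ (b + 1))
        ((a + 1) * (t ^ a * (1 - t) ^ (b + 1)) - (b + 1) * (t ^ (a + 1) * (1 - t) ^ b)) t := by
      intro t
      have h1 := (hasDerivAt_pow (a + 1) t).mul (((hasDerivAt_id t).const_sub 1).pow (b + 1))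
      convert! h1 using 1
      simp
      ring
    have h := intervalIntegral.integral_eq_sub_of_hasDerivAt (fun t _ => hd t)
      (a := 0) (b := 1) (Continuous.intervalIntegrable (by fun_prop) _ _)
    rw [intervalIntegral.integral_sub (Continuous.intervalIntegrable (by fun_prop) _ _)
      (Continuous.intervalIntegrable (by fun_prop) _ _), intervalIntegral.integral_const_mul,
      intervalIntegral.integral_const_mul, ih] at h
    have hf : a + (b + 1) + 1 = a + 1 + b + 1 := by ring
    rw [hf] at h
    have hb : (b + 1 : ℝ) ≠ 0 := by positivity
    apply mul_left_cancel₀ hb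
    simp at h
    rw [sub_eq_zero] at h
    rw [← h]
    simp only [Nat.factorial_succ a, Nat.factorial_succ b]
    push_cast
    ring

open Finset in
theorem sum_neg_one_pow_mul_choose_mul_choose_add {n j : ℕ} (h : j ≤ n) :
    ∑ k ∈ range (n + 1), (-1 : ℤ) ^ k * n.choose k * (j + k).choose j =
      if j = n then (-1) ^ n else 0 := by
  have key : (fwdDiff 1)^[n] (fun x ↦ x.choose j : ℕ → ℤ) j = if j = n then 1 else 0 := by
    obtain ⟨d, rfl⟩ := Nat.exists_eq_add_of_le' h
    have h0 := fwdDiff_iter_choose 0 j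
    simp only [add_zero, Nat.choose_zero_right] at h0
    rw [Function.iterate_add_apply, h0]
    cases d with
    | zero => simp
    | succ d =>
      rw [Function.iterate_succ_apply, fwdDiff_const]
      simp [fwdDiff_iter_eq_sum_shift]
  rw [fwdDiff_iter_eq_sum_shift] at key
  have : ∑ k ∈ range (n + 1), (-1 : ℤ) ^ k * n.choose k * (j + k).choose j =
      (-1) ^ n * ∑ k ∈ range (n + 1), ((-1 : ℤ) ^ (n - k) * n.choose k) • ((j + k • 1).choose j : ℤ) := by
    rw [mul_sum]
    refine sum_congr rfl fun k hk => ?_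
    have hk' : k ≤ n := by simpa [Nat.lt_succ_iff] using hk
    have : (-1 : ℤ) ^ n * (-1) ^ (n - k) = (-1) ^ k := by
      obtain ⟨d, rfl⟩ := Nat.exists_eq_add_of_le hk'
      rw [Nat.add_sub_cancel_left, pow_add, mul_assoc, ← pow_add, ← two_mul, pow_mul]
      simp
    simp only [smul_eq_mul, mul_one]
    rw [← this]
    ring
  rw [this, key]
  split_ifs <;> simp

open Finset in
theorem integral_rodrigues_mul_pow {n N j : ℕ} (hN : n ≤ N) (hj : j ≤ n) :
    ∫ t in (0:ℝ)..1, (∑ k ∈ range (n + 1),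
      (-1 : ℝ) ^ k * n.choose k * N.choose k * (t ^ k * (1 - t) ^ (N - k))) * t ^ j =
      if j = n then (-1) ^ n * (N.factorial * n.factorial : ℝ) / (n + N + 1).factorial else 0 := by
  have h1 : ∀ t : ℝ, (∑ k ∈ range (n + 1),
      (-1 : ℝ) ^ k * n.choose k * N.choose k * (t ^ k * (1 - t) ^ (N - k))) * t ^ j =
      ∑ k ∈ range (n + 1),
      ((-1 : ℝ) ^ k * n.choose k * N.choose k) * (t ^ (j + k) * (1 - t) ^ (N - k)) := by
    intro t
    rw [sum_mul]
    refine sum_congr rfl fun k _ => ?_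
    ring
  simp_rw [h1]
  rw [intervalIntegral.integral_finsetSum
    (fun k _ => Continuous.intervalIntegrable (by fun_prop) _ _)]
  simp_rw [intervalIntegral.integral_const_mul, integral_pow_mul_one_sub_pow]
  have h2 : ∀ k ∈ range (n + 1), ((-1 : ℝ) ^ k * n.choose k * N.choose k) *
      (((j + k).factorial * (N - k).factorial : ℝ) / (j + k + (N - k) + 1).factorial) =
      (N.factorial * j.factorial : ℝ) / (j + N + 1).factorial *
        (((-1 : ℤ) ^ k * n.choose k * (j + k).choose j : ℤ) : ℝ) := by
    intro k hk
    have hk' : k ≤ n := by simpa [Nat.lt_succ_iff] using hk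
    have hkN : k ≤ N := hk'.trans hN
    rw [show j + k + (N - k) + 1 = j + N + 1 by omega]
    push_cast
    rw [Nat.cast_choose ℝ hkN, Nat.cast_add_choose]
    field_simp
  rw [sum_congr rfl h2, ← mul_sum, ← Int.cast_sum, sum_neg_one_pow_mul_choose_mul_choose_add hj]
  split_ifs with h
  · subst h; push_cast; ring
  · simp

open Polynomial Finset in
theorem integral_jacobi_sq (n a : ℕ) :
    ∫ t in (0:ℝ)..1, (∑ k ∈ range (n + 1),
      (-1 : ℝ) ^ k * n.choose k * (n + 2 * a).choose k * (t ^ k * (1 - t) ^ (n + a - k))) ^ 2 =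
      1 / (2 * n + 2 * a + 1) := by
  set P : ℝ[X] := ∑ k ∈ range (n + 1),
    C ((-1 : ℝ) ^ k * n.choose k * (n + 2 * a).choose k) * (X ^ k * (1 - X) ^ (n - k)) with hP
  have hone : (1 - X : ℝ[X]).natDegree ≤ 1 := by
    simpa using natDegree_sub_le (1 : ℝ[X]) X
  have hterm : ∀ k ∈ range (n + 1), (X ^ k * (1 - X : ℝ[X]) ^ (n - k)).coeff n = (-1) ^ (n - k) := by
    intro k hk
    have hk' : k ≤ n := by simpa [Nat.lt_succ_iff] using hk
    obtain ⟨d, rfl⟩ := Nat.exists_eq_add_of_le hk'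
    rw [add_comm k d, coeff_X_pow_mul]
    have := coeff_pow_of_natDegree_le (m := d) hone
    simp only [mul_one] at this
    simp [this, coeff_one]
  have hdeg : P.natDegree < n + 1 := by
    rw [Nat.lt_succ_iff]
    refine natDegree_sum_le_of_forall_le _ _ fun k hk => ?_
    have hk' : k ≤ n := by simpa [Nat.lt_succ_iff] using hk
    refine (natDegree_C_mul_le _ _).trans (natDegree_mul_le.trans ?_)
    have h1 := natDegree_pow_le_of_le (n - k) hone
    rw [natDegree_X_pow]
    omega
  have hcoeff : P.coeff n = (-1) ^ n * (n + (n + 2 * a)).choose n := by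
    rw [hP, finsetSum_coeff, Nat.add_choose_eq, Finset.Nat.sum_antidiagonal_eq_sum_range_succ_mk,
      Nat.cast_sum, mul_sum, ← sum_range_reflect]
    refine sum_congr rfl fun k hk => ?_
    have hk' : k ≤ n := by simpa [Nat.lt_succ_iff] using hk
    rw [show n + 1 - 1 - k = n - k by omega, coeff_C_mul,
      hterm _ (by simp only [mem_range]; omega), Nat.choose_symm hk']
    have : (-1 : ℝ) ^ (n - k) * (-1) ^ (n - (n - k)) = (-1) ^ n := by
      rw [← pow_add]; congr 1; omega
    rw [← this]
    push_cast
    ring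
  have hsq : ∀ t : ℝ, (∑ k ∈ range (n + 1),
      (-1 : ℝ) ^ k * n.choose k * (n + 2 * a).choose k * (t ^ k * (1 - t) ^ (n + a - k))) ^ 2 =
      ∑ j ∈ range (n + 1), P.coeff j * ((∑ k ∈ range (n + 1), (-1 : ℝ) ^ k * n.choose k *
        (n + 2 * a).choose k * (t ^ k * (1 - t) ^ (n + 2 * a - k))) * t ^ j) := by
    intro t
    have hev : P.eval t = ∑ j ∈ range (n + 1), P.coeff j * t ^ j :=
      eval_eq_sum_range' hdeg t
    have h1 : ∀ b : ℕ, ∑ k ∈ range (n + 1), (-1 : ℝ) ^ k * n.choose k *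
        (n + 2 * a).choose k * (t ^ k * (1 - t) ^ (n + b - k)) = (1 - t) ^ b * P.eval t := by
      intro b
      rw [hP, eval_finsetSum, mul_sum]
      refine sum_congr rfl fun k hk => ?_
      have hk' : k ≤ n := by simpa [Nat.lt_succ_iff] using hk
      rw [show n + b - k = b + (n - k) by omega, pow_add]
      simp
      ring
    have h2 : ∀ w : ℝ, ∑ j ∈ range (n + 1), P.coeff j * (w * t ^ j) = w * P.eval t := by
      intro w
      rw [hev, mul_sum]
      exact sum_congr rfl fun j _ => by ring
    rw [h2, h1, h1]
    ring
  simp_rw [hsq]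
  rw [intervalIntegral.integral_finsetSum
    (fun k _ => Continuous.intervalIntegrable (by fun_prop) _ _)]
  simp_rw [intervalIntegral.integral_const_mul]
  rw [sum_range_succ, sum_eq_zero, zero_add,
    integral_rodrigues_mul_pow (by omega) le_rfl, if_pos rfl, hcoeff, Nat.cast_add_choose,
    Nat.factorial_succ]
  · have h1 : (-1 : ℝ) ^ n * (-1) ^ n = 1 := by rw [← mul_pow]; simp
    push_cast
    field_simp
    linear_combination (2 * n + 2 * a + 1 : ℝ) * h1
  · intro j hj
    rw [mem_range] at hj
    rw [integral_rodrigues_mul_pow (by omega) hj.le, if_neg hj.ne, mul_zero]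

theorem izbinom_sub_natCast {n k : ℕ} (hk : k ≤ n) : izbinom n ((n : ℤ) - k) = n.choose k := by
  have h : ((n : ℤ) - k).toNat = n - k := by omega
  rw [izbinom, if_pos (by omega), h, Int.toNat_natCast, Nat.choose_symm hk]

theorem izbinom_eq_zero {n j : ℤ} (h : ¬(0 ≤ j ∧ j ≤ n)) : izbinom n j = 0 := if_neg h

theorem izbinom_self {n : ℤ} (h : 0 ≤ n) : izbinom n n = 1 := by
  rw [izbinom, if_pos ⟨h, le_rfl⟩, Nat.choose_self]

theorem sY_eq_exp_mul (s l m : ℤ) (θ φ : ℝ) :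
    sY s l m (θ, φ) = Complex.exp (Complex.I * (m : ℂ) * (φ : ℂ)) * sY s l m (θ, 0) := by
  simp only [sY, Complex.ofReal_zero, mul_zero, Complex.exp_zero, one_mul, mul_assoc]

theorem alm_neg_div (s l : ℤ) :
    alm l (-s) / Real.sqrt (((l + s).toNat.factorial : ℝ) * ((l - s).toNat.factorial : ℝ)) =
      Real.sqrt ((2 * (l : ℝ) + 1) / (4 * Real.pi)) := by
  have h : (0 : ℝ) < ((l + s).toNat.factorial : ℝ) * ((l - s).toNat.factorial : ℝ) := by positivity
  rw [alm, ← sub_eq_add_neg, sub_neg_eq_add, mul_comm ((l - s).toNat.factorial : ℝ), mul_div_assoc,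
    Real.sqrt_mul h.le, mul_div_cancel_left₀ _ (Real.sqrt_pos.2 h).ne']

open Filter Topology in
theorem tendsto_sin_zpow_mul_cot_zpow {e L : ℤ} (h : e ≤ L) :
    Tendsto (fun θ : ℝ => (Real.sin (θ / 2) : ℂ) ^ L *
      ((Real.cos (θ / 2) / Real.sin (θ / 2) : ℝ) : ℂ) ^ e) (𝓝[>] 0)
      (𝓝 (if e = L then 1 else 0)) := by
  have hc : ContinuousAt (fun θ : ℝ => (Real.cos (θ / 2) : ℂ) ^ e *
      (Real.sin (θ / 2) : ℂ) ^ (L - e).toNat) 0 := by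
    refine ContinuousAt.mul (ContinuousAt.zpow₀ (by fun_prop) _ (Or.inl (by simp))) (by fun_prop)
  have hv : (Real.cos ((0 : ℝ) / 2) : ℂ) ^ e * (Real.sin ((0 : ℝ) / 2) : ℂ) ^ (L - e).toNat =
      if e = L then 1 else 0 := by
    split_ifs with he
    · simp [he]
    · have : (L - e).toNat ≠ 0 := by omega
      simp [this]
  have ht := hc.tendsto
  rw [hv] at ht
  refine (ht.mono_left nhdsWithin_le_nhds).congr' ?_
  filter_upwards [Ioo_mem_nhdsGT Real.pi_pos] with θ hθ
  have hs : (Real.sin (θ / 2) : ℂ) ≠ 0 := by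
    exact_mod_cast (Real.sin_pos_of_pos_of_lt_pi (by linarith [hθ.1]) (by linarith [hθ.1, hθ.2])).ne'
  rw [← zpow_natCast, Int.toNat_of_nonneg (by omega), zpow_sub₀ hs, Complex.ofReal_div, div_zpow]
  ring

open Filter Topology in
theorem tendsto_sY_zero (s l m : ℤ) (hl : |s| ≤ l) :
    Tendsto (fun θ : ℝ => sY s l m (θ, 0)) (𝓝[>] 0)
      (𝓝 (if m = -s then
        (-1 : ℂ) ^ (max s 0) * (Real.sqrt ((2 * (l : ℝ) + 1) / (4 * Real.pi)) : ℂ) else 0)) := by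
  obtain ⟨hl₁, hl₂⟩ := abs_le.1 hl
  set A : ℤ → ℂ := fun r => (izbinom (l - s) r : ℂ) * (izbinom (l + s) (r + s - m) : ℂ) *
    (-1 : ℂ) ^ (l - r - s) with hA
  have hsum : Tendsto (fun θ : ℝ => ∑ r ∈ Finset.Icc (0 : ℤ) (l - s),
      A r * ((Real.sin (θ / 2) : ℂ) ^ (2 * l) *
        ((Real.cos (θ / 2) / Real.sin (θ / 2) : ℝ) : ℂ) ^ (2 * r + s - m))) (𝓝[>] 0)
      (𝓝 (∑ r ∈ Finset.Icc (0 : ℤ) (l - s), A r * if 2 * r + s - m = 2 * l then 1 else 0)) := by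
    refine tendsto_finsetSum _ fun r hr => ?_
    rw [Finset.mem_Icc] at hr
    by_cases h : 0 ≤ r + s - m ∧ r + s - m ≤ l + s
    · exact (tendsto_sin_zpow_mul_cot_zpow (by omega)).const_mul _
    · have : A r = 0 := by simp [hA, izbinom_eq_zero h]
      simp [this]
  have hval : (∑ r ∈ Finset.Icc (0 : ℤ) (l - s), A r * if 2 * r + s - m = 2 * l then 1 else 0) =
      if m = -s then 1 else 0 := by
    split_ifs with hm
    · subst hm
      rw [Finset.sum_eq_single (l - s)]
      · rw [if_pos (by ring), hA]
        have : l - s + s - -s = l + s := by ring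
        simp only [this]
        rw [izbinom_self (by omega), izbinom_self (by omega)]
        simp
      · intro r _ hr
        rw [if_neg (by omega), mul_zero]
      · intro h
        exact absurd (Finset.mem_Icc.2 ⟨by omega, le_rfl⟩) h
    · refine Finset.sum_eq_zero fun r hr => ?_
      rw [Finset.mem_Icc] at hr
      by_cases h : 0 ≤ r + s - m ∧ r + s - m ≤ l + s
      · rw [if_neg (by omega), mul_zero]
      · simp [hA, izbinom_eq_zero h]
  rw [hval] at hsum
  have := hsum.const_mul ((-1 : ℂ) ^ (max (-m) 0) * ((alm l m /
    Real.sqrt (((l + s).toNat.factorial : ℝ) * ((l - s).toNat.factorial : ℝ)) : ℝ) : ℂ))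
  convert this using 1
  · ext θ
    simp only [sY, Complex.ofReal_zero, mul_zero, Complex.exp_zero, one_mul]
    rw [mul_assoc, Finset.mul_sum]
    congr 1
    refine Finset.sum_congr rfl fun r _ => ?_
    simp only [hA]
    ring
  · congr 1
    split_ifs with hm
    · subst hm
      rw [alm_neg_div, neg_neg, mul_one]
    · rw [mul_zero]

/-- The angular profile of `ₛY_{l,-s}` as a polynomial in `t = sin²(θ/2)`, where `l = n + |s|` and
`a = |s|`. -/
def zonalProfile (n a : ℕ) (t : ℝ) : ℝ :=
  ∑ k ∈ Finset.range (n + 1),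
    (-1 : ℝ) ^ k * n.choose k * (n + 2 * a).choose k * (t ^ k * (1 - t) ^ (n + a - k))

theorem sY_neg_eq_zonalProfile {s l : ℤ} {n : ℕ} (hl : l = n + s.natAbs) {θ : ℝ}
    (hθ : Real.sin (θ / 2) ≠ 0) :
    sY s l (-s) (θ, 0) =
      (-1 : ℂ) ^ (max s 0) * (Real.sqrt ((2 * (l : ℝ) + 1) / (4 * Real.pi)) : ℂ) *
        (zonalProfile n s.natAbs (Real.sin (θ / 2) ^ 2) : ℂ) := by
  simp only [sY, Complex.ofReal_zero, mul_zero, Complex.exp_zero, one_mul, alm_neg_div, neg_neg]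
  rw [mul_assoc]
  congr 1
  rw [Finset.mul_sum, zonalProfile, Complex.ofReal_sum]
  symm
  have hs : (Real.sin (θ / 2) : ℂ) ≠ 0 := by exact_mod_cast hθ
  refine Finset.sum_of_injOn (fun k : ℕ => l - s - k) (fun _ _ _ _ h => by simpa using h) ?_ ?_ ?_
  · intro k hk
    simp only [Finset.coe_range, Set.mem_Iio, Finset.coe_Icc, Set.mem_Icc] at hk ⊢
    omega
  · intro r hr hr'
    rw [Finset.mem_Icc] at hr
    have : ¬(0 ≤ r + s - -s ∧ r + s - -s ≤ l + s) ∨ ¬(0 ≤ r ∧ r ≤ l - s) := by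
      by_contra! h
      refine hr' ⟨(l - s - r).toNat, ?_, ?_⟩
      · simp only [Finset.coe_range, Set.mem_Iio]
        omega
      · simp only
        omega
    rcases this with h | h <;> simp only [izbinom_eq_zero h, Nat.cast_zero, mul_zero, zero_mul]
  · intro k hk
    have hk' : k ≤ n := by simpa [Nat.lt_succ_iff] using hk
    have hbin : (izbinom (l - s) (l - s - k) : ℂ) * (izbinom (l + s) (l - s - k + s - -s) : ℂ) =
        n.choose k * (n + 2 * s.natAbs).choose k := by
      rw [show l - s - k + s - -s = l + s - k by ring]
      rcases le_total 0 s with h | h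
      · rw [show l - s = (n : ℕ) by omega, show l + s = ((n + 2 * s.natAbs : ℕ) : ℤ) by omega,
          izbinom_sub_natCast hk', izbinom_sub_natCast (by omega)]
      · rw [show l + s = (n : ℕ) by omega, show l - s = ((n + 2 * s.natAbs : ℕ) : ℤ) by omega,
          izbinom_sub_natCast hk', izbinom_sub_natCast (by omega), mul_comm]
    have hcos : (1 : ℝ) - Real.sin (θ / 2) ^ 2 = Real.cos (θ / 2) ^ 2 := by
      rw [← Real.sin_sq_add_cos_sq (θ / 2)]; ring
    have hpow : (Real.sin (θ / 2) : ℂ) ^ (2 * l) *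
        ((Real.cos (θ / 2) / Real.sin (θ / 2) : ℝ) : ℂ) ^ (2 * (l - s - k) + s - -s) =
        (((Real.sin (θ / 2) ^ 2) ^ k * (Real.cos (θ / 2) ^ 2) ^ (n + s.natAbs - k) : ℝ) : ℂ) := by
      rw [show 2 * (l - s - k) + s - -s = ((2 * (n + s.natAbs - k) : ℕ) : ℤ) by omega,
        show 2 * l = ((2 * k + 2 * (n + s.natAbs - k) : ℕ) : ℤ) by omega, zpow_natCast,
        zpow_natCast, pow_add, pow_mul, pow_mul, pow_mul, Complex.ofReal_div, div_pow, div_pow]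
      push_cast at hs ⊢
      field_simp
    rw [show l - (l - s - k) - s = ((k : ℕ) : ℤ) by ring, zpow_natCast, hbin, hcos,
      mul_left_comm (_ ^ (2 * l)), hpow]
    push_cast
    ring

theorem integral_zonalProfile_sq_mul_sin (n a : ℕ) :
    ∫ θ in (0:ℝ)..Real.pi, zonalProfile n a (Real.sin (θ / 2) ^ 2) ^ 2 * Real.sin θ =
      2 / (2 * (n + a) + 1) := by
  have hd : ∀ θ ∈ Set.uIcc 0 Real.pi, HasDerivAt (fun θ : ℝ => Real.sin (θ / 2) ^ 2)
      (Real.sin θ / 2) θ := by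
    intro θ _
    have h := (((Real.hasDerivAt_sin (θ / 2)).comp θ ((hasDerivAt_id θ).div_const 2)).pow 2)
    convert! h using 1
    have : Real.sin θ = 2 * Real.sin (θ / 2) * Real.cos (θ / 2) := by
      rw [← Real.sin_two_mul]; ring_nf
    simp [this]
    ring
  have hcont : Continuous fun t : ℝ => zonalProfile n a t ^ 2 := by
    unfold zonalProfile
    fun_prop
  have h := intervalIntegral.integral_comp_mul_deriv hd (by fun_prop) hcont
  have hjac := integral_jacobi_sq n a
  simp only [Function.comp_def, zero_div, Real.sin_zero, Real.sin_pi_div_two, one_pow,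
    zero_pow two_ne_zero] at h
  simp only [zonalProfile] at h ⊢
  rw [hjac] at h
  simp_rw [← mul_div_assoc] at h
  rw [intervalIntegral.integral_div, div_eq_iff two_ne_zero] at h
  rw [h]
  ring

theorem integral_exp_I_mul_int (k : ℤ) :
    ∫ φ in (-Real.pi)..Real.pi, Complex.exp (Complex.I * (k : ℂ) * (φ : ℂ)) =
      if k = 0 then 2 * (Real.pi : ℂ) else 0 := by
  split_ifs with hk
  · subst hk
    simp
    ring
  · have hk' : Complex.I * (k : ℂ) ≠ 0 := mul_ne_zero Complex.I_ne_zero (by exact_mod_cast hk)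
    rw [integral_exp_mul_complex hk', div_eq_zero_iff, sub_eq_zero]
    left
    rw [Complex.exp_eq_exp_iff_exists_int]
    exact ⟨k, by push_cast; ring⟩

theorem integral_sum_sY_mul_conj_sZ (s l : ℤ) (hl : |s| ≤ l) (c : ℤ → ℂ) (θ : ℝ) :
    ∫ φ in (-Real.pi)..Real.pi, (∑ m ∈ Finset.Icc (-l) l, c m * sY s l m (θ, φ)) *
        (starRingEnd ℂ) (sZ s l (θ, φ)) =
      2 * Real.pi * (c (-s) * sY s l (-s) (θ, 0)) * (starRingEnd ℂ) (sZ s l (θ, 0)) := by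
  have h1 : ∀ φ : ℝ, (∑ m ∈ Finset.Icc (-l) l, c m * sY s l m (θ, φ)) *
      (starRingEnd ℂ) (sZ s l (θ, φ)) = ∑ m ∈ Finset.Icc (-l) l,
        (c m * sY s l m (θ, 0) * (starRingEnd ℂ) (sZ s l (θ, 0))) *
          Complex.exp (Complex.I * ((m + s : ℤ) : ℂ) * (φ : ℂ)) := by
    intro φ
    rw [Finset.sum_mul]
    refine Finset.sum_congr rfl fun m _ => ?_
    rw [sZ, sZ, sY_eq_exp_mul s l m, sY_eq_exp_mul s l (-s) θ φ, map_mul, map_mul, map_mul,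
      map_mul _ _ (sY s l (-s) (θ, 0)), ← Complex.exp_conj]
    have : Complex.exp (Complex.I * ((m + s : ℤ) : ℂ) * (φ : ℂ)) =
        Complex.exp (Complex.I * (m : ℂ) * (φ : ℂ)) *
          Complex.exp ((starRingEnd ℂ) (Complex.I * ((-s : ℤ) : ℂ) * (φ : ℂ))) := by
      rw [← Complex.exp_add]
      congr 1
      simp
      ring
    rw [this, map_mul (starRingEnd ℂ) (_ ^ _)]
    ring
  simp_rw [h1]
  rw [intervalIntegral.integral_finsetSum
    (fun m _ => Continuous.intervalIntegrable (by fun_prop) _ _)]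
  simp_rw [intervalIntegral.integral_const_mul, integral_exp_I_mul_int]
  obtain ⟨hl₁, hl₂⟩ := abs_le.1 hl
  rw [Finset.sum_eq_single (-s)]
  · rw [if_pos (by ring)]
    ring
  · intro m _ hm
    rw [if_neg (by omega), mul_zero]
  · intro h
    exact absurd (Finset.mem_Icc.2 ⟨by omega, by omega⟩) h

/-- **The linear functional `L` on `ℋ_{ls}` is given by pairing with the zonal harmonic**
(Statement 9). -/
theorem limit_eq_inner_sZ (s l : ℤ) (hl : |s| ≤ l) (c : ℤ → ℂ) :
    (∀ ε : ℝ, 0 < ε → ∃ δ : ℝ, 0 < δ ∧ ∀ θ φ : ℝ, 0 < θ → θ < δ →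
      ‖Complex.exp (Complex.I * (s : ℂ) * (φ : ℂ)) *
          (∑ m ∈ Finset.Icc (-l) l, c m * sY s l m (θ, φ)) -
        (-1 : ℂ) ^ (max s 0) * (Real.sqrt ((2 * (l : ℝ) + 1) / (4 * Real.pi)) : ℂ) * c (-s)‖ < ε) ∧
    (-1 : ℂ) ^ (max s 0) * (Real.sqrt ((2 * (l : ℝ) + 1) / (4 * Real.pi)) : ℂ) * c (-s) =
      ∫ θ in (0:ℝ)..Real.pi,
        (∫ φ in (-Real.pi)..Real.pi,
          (∑ m ∈ Finset.Icc (-l) l, c m * sY s l m (θ, φ)) *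
            (starRingEnd ℂ) (sZ s l (θ, φ))) * (Real.sin θ : ℂ) := by
  obtain ⟨hl₁, hl₂⟩ := abs_le.1 hl
  set ε₀ : ℂ := (-1 : ℂ) ^ (max s 0) with hε₀
  set K : ℝ := Real.sqrt ((2 * (l : ℝ) + 1) / (4 * Real.pi)) with hK
  constructor
  · intro ε hε
    have hlim : Filter.Tendsto (fun θ : ℝ => ∑ m ∈ Finset.Icc (-l) l,
        ‖c m‖ * ‖sY s l m (θ, 0) - if m = -s then ε₀ * K else 0‖) (nhdsWithin 0 (Set.Ioi 0)) (nhds 0) := by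
      have hterm : ∀ m ∈ Finset.Icc (-l) l, Filter.Tendsto (fun θ : ℝ =>
          ‖c m‖ * ‖sY s l m (θ, 0) - if m = -s then ε₀ * K else 0‖)
          (nhdsWithin 0 (Set.Ioi 0)) (nhds 0) := by
        intro m _
        have := (((tendsto_sY_zero s l m hl).sub_const
          (if m = -s then ε₀ * K else 0)).norm).const_mul ‖c m‖
        rwa [sub_self, norm_zero, mul_zero] at this
      simpa using tendsto_finsetSum _ hterm
    obtain ⟨δ, hδ, hsub⟩ := mem_nhdsGT_iff_exists_Ioo_subset.1 (hlim.eventually_lt_const hε)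
    refine ⟨δ, hδ, fun θ φ h0 h1 => lt_of_le_of_lt ?_ (hsub ⟨h0, h1⟩)⟩
    have hconst : ε₀ * K * c (-s) = Complex.exp (Complex.I * (s : ℂ) * (φ : ℂ)) *
        ∑ m ∈ Finset.Icc (-l) l, c m * (Complex.exp (Complex.I * (m : ℂ) * (φ : ℂ)) *
          if m = -s then ε₀ * K else 0) := by
      rw [Finset.sum_eq_single (-s)]
      · have : Complex.exp (Complex.I * (s : ℂ) * (φ : ℂ)) *
            Complex.exp (Complex.I * ((-s : ℤ) : ℂ) * (φ : ℂ)) = 1 := by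
          rw [← Complex.exp_add, Complex.exp_eq_one_iff]
          exact ⟨0, by push_cast; ring⟩
        rw [if_pos rfl]
        linear_combination (-(ε₀ * K * c (-s))) * this
      · intro m _ hm
        rw [if_neg hm]
        ring
      · intro h
        exact absurd (Finset.mem_Icc.2 ⟨by omega, by omega⟩) h
    have hexp : ∀ k : ℤ, ‖Complex.exp (Complex.I * (k : ℂ) * (φ : ℂ))‖ = 1 := by
      intro k
      rw [mul_assoc, mul_comm]
      exact_mod_cast Complex.norm_exp_ofReal_mul_I (k * φ)
    rw [hconst, ← mul_sub, norm_mul, hexp, one_mul, ← Finset.sum_sub_distrib]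
    refine (norm_sum_le _ _).trans (Finset.sum_le_sum fun m _ => ?_)
    rw [sY_eq_exp_mul, ← mul_sub, ← mul_sub, norm_mul, norm_mul, hexp, one_mul]
  · obtain ⟨n, hn⟩ : ∃ n : ℕ, l = n + s.natAbs := ⟨(l - s.natAbs).toNat, by omega⟩
    have hl0 : (0 : ℝ) < 2 * l + 1 := by
      have : (0 : ℤ) ≤ l := by omega
      have : (0 : ℝ) ≤ l := by exact_mod_cast this
      linarith
    have hKsq : K ^ 2 = (2 * (l : ℝ) + 1) / (4 * Real.pi) :=
      Real.sq_sqrt (by positivity)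
    have hconj : (starRingEnd ℂ) ε₀ = ε₀ := by simp [hε₀, map_zpow₀]
    have hsq : ε₀ * ε₀ = 1 := by
      rw [hε₀, ← mul_zpow]; simp
    have hint : Set.EqOn (fun θ : ℝ => (∫ φ in (-Real.pi)..Real.pi,
          (∑ m ∈ Finset.Icc (-l) l, c m * sY s l m (θ, φ)) *
            (starRingEnd ℂ) (sZ s l (θ, φ))) * (Real.sin θ : ℂ))
        (fun θ => (ε₀ * K * c (-s) * (2 * Real.pi * K ^ 2)) *
          ((zonalProfile n s.natAbs (Real.sin (θ / 2) ^ 2) ^ 2 * Real.sin θ : ℝ) : ℂ))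
        (Set.uIcc 0 Real.pi) := by
      intro θ _
      simp only
      by_cases hθ : Real.sin (θ / 2) = 0
      · have : Real.sin θ = 0 := by
          rw [show θ = 2 * (θ / 2) by ring, Real.sin_two_mul, hθ]; ring
        simp only [this, Complex.ofReal_zero, mul_zero]
      · rw [integral_sum_sY_mul_conj_sZ s l hl c θ, sZ, sY_neg_eq_zonalProfile hn hθ]
        simp only [map_mul, Complex.conj_ofReal, ← hε₀, ← hK, hconj]
        push_cast
        linear_combination (2 * Real.pi * c (-s) * ε₀ * K ^ 3 *
          (zonalProfile n s.natAbs (Real.sin (θ / 2) ^ 2) : ℂ) ^ 2 * Complex.sin θ) * hsq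
    rw [intervalIntegral.integral_congr hint, intervalIntegral.integral_const_mul,
      intervalIntegral.integral_ofReal, integral_zonalProfile_sq_mul_sin]
    have hone : 2 * Real.pi * K ^ 2 * (2 / (2 * ((n : ℝ) + s.natAbs) + 1)) = 1 := by
      have hln : (l : ℝ) = n + s.natAbs := by rw [hn]; simp
      rw [hKsq, ← hln]
      field_simp
      norm_num
    have hone' := congrArg (Complex.ofReal) hone
    rw [Complex.ofReal_mul, Complex.ofReal_mul, Complex.ofReal_mul, Complex.ofReal_pow,
      Complex.ofReal_one, Complex.ofReal_ofNat] at hone'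
    linear_combination (-(ε₀ * K * c (-s))) * hone'
end
end

section
/- Let s be an integer and l ≥ |s|. Then for every (θ,φ) ∈ (0,π)×ℝ, Σ_{m=−l}^{l} |ₛY_{lm}(θ,φ)|² = (2l+1)/(4π). -/
noncomputable section

open Polynomial in
/-- Multiplication by a linear form is adjoint to the corresponding directional derivative for the
(unnormalized) Bombieri pairing of binary forms, written in dehomogenized coordinates. -/
theorem bombieri_pairing_linear_mul (N : ℕ) (p q : ℝ[X]) (hq : q.natDegree ≤ N) (α β : ℝ) :
    ∑ k ∈ Finset.range (N + 1 + 1),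
        ((k.factorial * (N + 1 - k).factorial : ℕ) : ℝ) * p.coeff k *
          ((C α * X + C β) * q).coeff k =
      ∑ k ∈ Finset.range (N + 1),
        ((k.factorial * (N - k).factorial : ℕ) : ℝ) *
          ((C α - C β * X) * derivative p + C (β * (N + 1)) * p).coeff k * q.coeff k := by
  have hq' : q.coeff (N + 1) = 0 := coeff_eq_zero_of_natDegree_lt (by omega)
  have h1 : ∀ k, ((C α * X + C β) * q).coeff k = α * (X * q).coeff k + β * q.coeff k := by
    intro k
    rw [add_mul, mul_assoc, coeff_add, coeff_C_mul, coeff_C_mul]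
  have h2 : ∀ k, ((C α - C β * X) * derivative p + C (β * (N + 1)) * p).coeff k =
      α * (p.coeff (k + 1) * (k + 1)) + β * (N + 1 - k) * p.coeff k := by
    intro k
    rw [sub_mul, mul_assoc, coeff_add, coeff_sub, coeff_C_mul, coeff_C_mul, coeff_C_mul,
      coeff_derivative]
    cases k with
    | zero => simp
    | succ k => rw [coeff_X_mul, coeff_derivative]; push_cast; ring
  simp only [h1, h2]
  simp only [mul_add (_ * _), mul_add (Nat.cast _), add_mul _ _ (q.coeff _), Finset.sum_add_distrib]
  congr 1
  · rw [Finset.sum_range_succ']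
    simp only [coeff_X_mul, mul_coeff_zero, coeff_X_zero, zero_mul, mul_zero, add_zero]
    refine Finset.sum_congr rfl fun k _ => ?_
    rw [Nat.add_sub_add_right, Nat.factorial_succ]
    push_cast
    ring
  · rw [Finset.sum_range_succ, hq', mul_zero, mul_zero, add_zero]
    refine Finset.sum_congr rfl fun k hk => ?_
    obtain ⟨d, rfl⟩ := Nat.exists_eq_add_of_le (Nat.lt_succ_iff.mp (Finset.mem_range.mp hk))
    rw [show k + d + 1 - k = d + 1 by omega, show k + d - k = d by omega, Nat.factorial_succ]
    push_cast
    ring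

open Polynomial in
/-- The Bombieri norm of a product of powers of two orthonormal linear forms. -/
theorem bombieri_norm_orthonormal (c t : ℝ) (h : c ^ 2 + t ^ 2 = 1) (a b : ℕ) :
    ∑ k ∈ Finset.range (a + b + 1), ((k.factorial * (a + b - k).factorial : ℕ) : ℝ) *
      ((C c * X + C (-t)) ^ b * (C t * X + C c) ^ a : ℝ[X]).coeff k ^ 2 =
      a.factorial * b.factorial := by
  have hC : (C c * C c + C t * C t : ℝ[X]) = 1 := by
    rw [← C_mul, ← C_mul, ← C_add, ← C_1]; congr 1; linarith
  induction b with
  | zero =>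
    induction a with
    | zero => simp
    | succ a ih =>
      simp only [pow_zero, one_mul, add_zero, Nat.factorial_zero, Nat.cast_one, mul_one] at ih ⊢
      have key := bombieri_pairing_linear_mul a ((C t * X + C c) ^ (a + 1)) ((C t * X + C c) ^ a)
        (natDegree_pow_le_of_le a natDegree_linear_le |>.trans (by simp)) t c
      have hD : (C t - C c * X) * derivative ((C t * X + C c : ℝ[X]) ^ (a + 1)) +
          C (c * (a + 1)) * (C t * X + C c) ^ (a + 1) =
          C ((a : ℝ) + 1) * (C t * X + C c) ^ a := by
        simp only [derivative_pow, derivative_add, derivative_mul, derivative_C, derivative_X,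
          C_mul, C_add, C_1, Nat.add_sub_cancel, Nat.cast_add, Nat.cast_one]
        linear_combination (C (a : ℝ) + 1) * (C t * X + C c) ^ a * hC
      rw [hD] at key
      simp only [← pow_succ', coeff_C_mul] at key
      rw [Nat.factorial_succ, Nat.cast_mul, ← ih, Finset.mul_sum]
      refine Eq.trans ?_ (key.trans ?_)
      · exact Finset.sum_congr rfl fun k _ => by ring
      · exact Finset.sum_congr rfl fun k _ => by push_cast; ring
  | succ b ih =>
    have hdeg : ((C c * X + C (-t)) ^ b * (C t * X + C c) ^ a : ℝ[X]).natDegree ≤ a + b := by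
      refine (natDegree_mul_le_of_le (natDegree_pow_le_of_le b natDegree_linear_le)
        (natDegree_pow_le_of_le a natDegree_linear_le)).trans ?_
      omega
    have key := bombieri_pairing_linear_mul (a + b)
      ((C c * X + C (-t)) ^ (b + 1) * (C t * X + C c) ^ a) _ hdeg c (-t)
    have hD : (C c - C (-t) * X) *
          derivative ((C c * X + C (-t)) ^ (b + 1) * (C t * X + C c) ^ a : ℝ[X]) +
        C (-t * ((a + b : ℕ) + 1)) * ((C c * X + C (-t)) ^ (b + 1) * (C t * X + C c) ^ a) =
        C ((b : ℝ) + 1) * ((C c * X + C (-t)) ^ b * (C t * X + C c) ^ a) := by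
      cases a with
      | zero =>
        simp only [derivative_pow, derivative_add, derivative_mul, derivative_C, derivative_X,
          C_mul, C_add, C_1, C_neg, derivative_neg, Nat.add_sub_cancel, Nat.cast_add, Nat.cast_one,
          Nat.cast_zero, C_0, pow_zero, derivative_one]
        linear_combination (C (b : ℝ) + 1) * (C c * X - C t) ^ b * hC
      | succ a =>
        simp only [derivative_pow, derivative_add, derivative_mul, derivative_C, derivative_X,
          C_mul, C_add, C_1, C_neg, derivative_neg, Nat.add_sub_cancel, Nat.cast_add, Nat.cast_one]
        linear_combination (C (b : ℝ) + 1) * (C c * X - C t) ^ b * (C t * X + C c) ^ (a + 1) * hC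
    rw [hD] at key
    simp only [← mul_assoc, ← pow_succ'] at key
    simp only [mul_assoc, coeff_C_mul] at key
    rw [Nat.factorial_succ, Nat.cast_mul, mul_left_comm, ← ih, Finset.mul_sum]
    refine Eq.trans ?_ (key.trans ?_)
    · exact Finset.sum_congr rfl fun k _ => by rw [sq]; rfl
    · exact Finset.sum_congr rfl fun k _ => by push_cast; ring

open Polynomial in
theorem coeff_linear_pow (α β : ℝ) (n i : ℕ) :
    ((C α * X + C β) ^ n : ℝ[X]).coeff i = n.choose i * α ^ i * β ^ (n - i) := by
  have h : (C α * X + C β : ℝ[X]) = (X + C β).comp (C α * X) := by simp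
  rw [h, ← pow_comp, comp_C_mul_X_coeff, coeff_X_add_C_pow]
  ring

open Polynomial in
theorem coeff_linear_pow_mul_linear_pow (c t : ℝ) (a b k : ℕ) :
    ((C c * X + C (-t)) ^ b * (C t * X + C c) ^ a : ℝ[X]).coeff k =
      ∑ r ∈ Finset.range (b + 1), b.choose r * c ^ r * (-t) ^ (b - r) *
        if r ≤ k then a.choose (k - r) * t ^ (k - r) * c ^ (a - (k - r)) else 0 := by
  have h : (C c * X + C (-t)) ^ b =
      ∑ r ∈ Finset.range (b + 1), C ((b.choose r : ℝ) * c ^ r * (-t) ^ (b - r)) * X ^ r := by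
    rw [add_pow]
    refine Finset.sum_congr rfl fun r _ => ?_
    simp only [C_mul, C_pow, ← C_eq_natCast, mul_pow]
    ring
  rw [h, Finset.sum_mul, finsetSum_coeff]
  refine Finset.sum_congr rfl fun r _ => ?_
  rw [mul_assoc, coeff_C_mul, coeff_X_pow_mul', coeff_linear_pow]

open Polynomial in
/-- Up to a phase and normalization, the spin-weighted harmonics in the chart are the coefficients
of a product of powers of two linear forms. -/
theorem norm_sY_sq (s l : ℤ) (a b k : ℕ) (ha : l + s = a) (hb : l - s = b) (hk : k ≤ a + b)
    (θ φ : ℝ) (hθ : θ ∈ Set.Ioo 0 Real.pi) :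
    ‖sY s l (k - l) (θ, φ)‖ ^ 2 = (2 * (l : ℝ) + 1) / (4 * Real.pi) /
      (a.factorial * b.factorial) * (((k.factorial * (a + b - k).factorial : ℕ) : ℝ) *
      ((C (Real.cos (θ / 2)) * X + C (-Real.sin (θ / 2))) ^ b *
        (C (Real.sin (θ / 2)) * X + C (Real.cos (θ / 2))) ^ a : ℝ[X]).coeff k ^ 2) := by
  have hc : Real.cos (θ / 2) ≠ 0 :=
    (Real.cos_pos_of_mem_Ioo ⟨by linarith [hθ.1, Real.pi_pos], by linarith [hθ.2]⟩).ne'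
  have ht : Real.sin (θ / 2) ≠ 0 :=
    (Real.sin_pos_of_pos_of_lt_pi (by linarith [hθ.1]) (by linarith [hθ.1, hθ.2])).ne'
  have hsum : ((Real.sin (θ / 2) : ℂ)) ^ (2 * l) *
      ∑ r ∈ Finset.Icc (0 : ℤ) (l - s),
        (izbinom (l - s) r : ℂ) * (izbinom (l + s) (r + s - (k - l)) : ℂ) *
          (-1 : ℂ) ^ (l - r - s) *
          ((Real.cos (θ / 2) / Real.sin (θ / 2) : ℝ) : ℂ) ^ (2 * r + s - (k - l)) =
      ((((C (Real.cos (θ / 2)) * X + C (-Real.sin (θ / 2))) ^ b *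
        (C (Real.sin (θ / 2)) * X + C (Real.cos (θ / 2))) ^ a : ℝ[X]).coeff k : ℝ) : ℂ) := by
    rw [coeff_linear_pow_mul_linear_pow]
    generalize Real.cos (θ / 2) = c at *
    generalize Real.sin (θ / 2) = t at *
    have hN : 2 * l = a + b := by omega
    have hIcc : Finset.Icc (0 : ℤ) (l - s) =
        (Finset.range (b + 1)).map Nat.castEmbedding := by
      ext x
      simp only [Finset.mem_Icc, Finset.mem_map, Finset.mem_range, Nat.castEmbedding_apply]
      constructor
      · rintro ⟨h0, h1⟩
        exact ⟨x.toNat, by omega, by omega⟩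
      · rintro ⟨r, hr, rfl⟩
        omega
    rw [hIcc, Finset.sum_map, Finset.mul_sum, Complex.ofReal_sum]
    refine Finset.sum_congr rfl fun r hr => ?_
    rw [Finset.mem_range] at hr
    simp only [Nat.castEmbedding_apply]
    have hz1 : izbinom (l - s) r = b.choose r := by
      rw [izbinom, if_pos (by omega), hb]; simp
    rw [hz1]
    by_cases hrk : r ≤ k
    · by_cases hka : k - r ≤ a
      · have hz2 : izbinom (l + s) (r + s - (k - l)) = a.choose (k - r) := by
          rw [izbinom, if_pos (by omega), ← Nat.choose_symm hka, ha]
          congr 1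
          omega
        obtain ⟨i, rfl⟩ := Nat.exists_eq_add_of_le hrk
        rw [Nat.add_sub_cancel_left] at hka hz2
        obtain ⟨j, rfl⟩ := Nat.exists_eq_add_of_le hka
        obtain ⟨u, rfl⟩ := Nat.exists_eq_add_of_le (Nat.lt_succ_iff.mp hr)
        rw [hz2, if_pos hrk, Nat.add_sub_cancel_left, Nat.add_sub_cancel_left,
          Nat.add_sub_cancel_left, hN, show l - r - s = (u : ℤ) by omega,
          show (2 * r + s - ((r + i : ℕ) - l) : ℤ) = ((r + j : ℕ) : ℤ) by push_cast at *; omega,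
          show (((i + j : ℕ) : ℤ) + (r + u : ℕ)) = ((i + u + (r + j) : ℕ) : ℤ) by
            push_cast; ring,
          zpow_natCast, zpow_natCast, zpow_natCast]
        have ht' : (t : ℂ) ≠ 0 := by exact_mod_cast ht
        push_cast
        rw [div_pow, neg_pow (t : ℂ) u]
        field_simp
        ring
      · have hz2 : izbinom (l + s) (r + s - (k - l)) = 0 := by
          rw [izbinom, if_neg (by omega)]
        rw [hz2, if_pos hrk, Nat.choose_eq_zero_of_lt (not_le.mp hka)]
        simp
    · have hz2 : izbinom (l + s) (r + s - (k - l)) = 0 := by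
        rw [izbinom, if_neg (by omega)]
      rw [hz2, if_neg hrk]
      simp
  have hl : (0 : ℝ) ≤ 2 * (l : ℝ) + 1 := by
    have : (0 : ℤ) ≤ 2 * l + 1 := by omega
    exact_mod_cast this
  have hphase : ‖Complex.exp (Complex.I * ((k - l : ℤ) : ℂ) * (φ : ℂ))‖ = 1 := by
    rw [Complex.norm_exp]
    simp
  simp only [sY]
  rw [mul_assoc _ (_ ^ (2 * l)), hsum, norm_mul, norm_mul, norm_mul, hphase, norm_zpow, norm_neg,
    norm_one, one_zpow, one_mul, one_mul, Complex.norm_real, Complex.norm_real, mul_pow,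
    Real.norm_eq_abs, Real.norm_eq_abs, sq_abs, sq_abs, div_pow, alm, Real.sq_sqrt (by positivity),
    Real.sq_sqrt (by positivity), ha, hb, show l + (k - l) = (k : ℤ) by ring,
    show l - (k - l) = ((a + b - k : ℕ) : ℤ) by omega]
  simp only [Int.toNat_natCast]
  push_cast
  ring

/-- **The addition formula on the diagonal: `Σ_m |ₛY_{lm}|² = (2l+1)/(4π)`** (Statement 10). -/
theorem sY_sum_sq (s l : ℤ) (hl : |s| ≤ l) (θ φ : ℝ) (hθ : θ ∈ Set.Ioo 0 Real.pi) :
    ∑ m ∈ Finset.Icc (-l) l, ‖sY s l m (θ, φ)‖ ^ 2 = (2 * (l : ℝ) + 1) / (4 * Real.pi) := by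
  obtain ⟨hs1, hs2⟩ := abs_le.mp hl
  obtain ⟨a, ha⟩ := Int.eq_ofNat_of_zero_le (show 0 ≤ l + s by omega)
  obtain ⟨b, hb⟩ := Int.eq_ofNat_of_zero_le (show 0 ≤ l - s by omega)
  have hreindex : ∑ m ∈ Finset.Icc (-l) l, ‖sY s l m (θ, φ)‖ ^ 2 =
      ∑ k ∈ Finset.range (a + b + 1), ‖sY s l (k - l) (θ, φ)‖ ^ 2 := by
    symm
    refine Finset.sum_bij (fun k _ => (k : ℤ) - l) ?_ ?_ ?_ fun _ _ => rfl
    · intro k hk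
      rw [Finset.mem_range] at hk
      rw [Finset.mem_Icc]
      omega
    · intro k _ k' _ h
      simpa using h
    · intro m hm
      rw [Finset.mem_Icc] at hm
      exact ⟨(m + l).toNat, by rw [Finset.mem_range]; omega, by omega⟩
  rw [hreindex, Finset.sum_congr rfl fun k hk => norm_sY_sq s l a b k ha hb
    (Nat.lt_succ_iff.mp (Finset.mem_range.mp hk)) θ φ hθ, ← Finset.mul_sum,
    bombieri_norm_orthonormal _ _ (Real.cos_sq_add_sin_sq _) a b]
  exact div_mul_cancel₀ _ (by positivity)
end
end

section
/- Let s > 0 be an integer and l ≥ s. Write ð^{[s]} = ð_{s−1} ∘ ⋯ ∘ ð_0 and define ∂̄^{[s]} h = conj(ð^{[s]}(conj h)). Then for all (θ,φ), (θ',φ') ∈ (0,π)×ℝ, Σ_{m=−l}^{l} ₛY_{lm}(θ,φ) · conj(ₛY_{lm}(θ',φ')) = ((l−s)!/(l+s)!) · [ð^{[s]} acting in (θ,φ)] [∂̄^{[s]} acting in (θ',φ')] applied to Σ_{m=−l}^{l} Y_{lm}(θ,φ) · conj(Y_{lm}(θ',φ')), where Y_{lm} = ₀Y_{lm}. -/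
noncomputable section

/-- Partial derivative in the first variable. -/
noncomputable def pdθ (h : ℝ × ℝ → ℂ) : ℝ × ℝ → ℂ := fun x => deriv (fun t => h (t, x.2)) x.1

/-- Partial derivative in the second variable. -/
noncomputable def pdφ (h : ℝ × ℝ → ℂ) : ℝ × ℝ → ℂ := fun x => deriv (fun t => h (x.1, t)) x.2
/-- The spin-raising operator `ð_s` in the standard chart. -/
noncomputable def eth (s : ℤ) (h : ℝ × ℝ → ℂ) : ℝ × ℝ → ℂ := fun x =>
  -((Real.sin x.1 : ℂ) ^ s) *
    (pdθ (fun y => (Real.sin y.1 : ℂ) ^ (-s) * h y) x +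
      Complex.I / (Real.sin x.1 : ℂ) * pdφ (fun y => (Real.sin y.1 : ℂ) ^ (-s) * h y) x)

/-- The spin-lowering operator `ð̄_s` in the standard chart. -/
noncomputable def ethbar (s : ℤ) (h : ℝ × ℝ → ℂ) : ℝ × ℝ → ℂ := fun x =>
  -((Real.sin x.1 : ℂ) ^ (-s)) *
    (pdθ (fun y => (Real.sin y.1 : ℂ) ^ s * h y) x -
      Complex.I / (Real.sin x.1 : ℂ) * pdφ (fun y => (Real.sin y.1 : ℂ) ^ s * h y) x)

/-- `ð^{[n]} = ð_{n−1} ∘ ⋯ ∘ ð_0`. -/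
noncomputable def ethIter : ℕ → (ℝ × ℝ → ℂ) → (ℝ × ℝ → ℂ)
  | 0, h => h
  | n + 1, h => eth (n : ℤ) (ethIter n h)

/-- `∂̄^{[n]} h = conj (ð^{[n]} (conj h))`. -/
noncomputable def ethbarIterConj (n : ℕ) (h : ℝ × ℝ → ℂ) : ℝ × ℝ → ℂ :=
  fun x => (starRingEnd ℂ) (ethIter n (fun y => (starRingEnd ℂ) (h y)) x)

lemma izbinom_natCast (n k : ℕ) : izbinom n k = n.choose k := by
  by_cases h : k ≤ n
  · simp [izbinom, h]
  · simp [izbinom, h, Nat.choose_eq_zero_of_lt (not_le.mp h)]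

/-- Pascal's rule for `izbinom`. -/
lemma izbinom_succ_succ {n : ℤ} (hn : 0 ≤ n) (j : ℤ) :
    izbinom (n + 1) (j + 1) = izbinom n j + izbinom n (j + 1) := by
  lift n to ℕ using hn
  rcases lt_or_ge j 0 with hj | hj
  · rcases eq_or_ne j (-1) with rfl | hj'
    · have h : (0 : ℤ) ≤ n + 1 := by omega
      simp [izbinom, h]
    · have h1 : ¬ 0 ≤ j + 1 := by omega
      have h2 : ¬ 0 ≤ j := by omega
      simp [izbinom, h1, h2]
  · lift j to ℕ using hj
    have h := Nat.choose_succ_succ' n j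
    rw [← izbinom_natCast, ← izbinom_natCast, ← izbinom_natCast] at h
    exact_mod_cast h

/-- The `θ`-dependence of `ₛY_{lm}`, without its normalization. -/
def polarPart (s l : ℕ) (m : ℤ) (t : ℝ) : ℝ :=
  ∑ r ∈ Finset.range (l - s + 1),
    ((l - s).choose r : ℝ) * (izbinom (l + s) (r + s - m) : ℝ) * (-1) ^ ((l : ℤ) - r - s) *
      (Real.cos (t / 2) ^ (2 * (r : ℤ) + s - m) *
        Real.sin (t / 2) ^ (2 * (l : ℤ) - (2 * r + s - m)))

lemma sin_half_pos {t : ℝ} (ht : t ∈ Set.Ioo 0 Real.pi) : 0 < Real.sin (t / 2) :=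
  Real.sin_pos_of_pos_of_lt_pi (by linarith [ht.1]) (by linarith [ht.1, ht.2])

lemma cos_half_pos {t : ℝ} (ht : t ∈ Set.Ioo 0 Real.pi) : 0 < Real.cos (t / 2) :=
  Real.cos_pos_of_mem_Ioo ⟨by linarith [ht.1, Real.pi_pos], by linarith [ht.2]⟩

lemma sY_eq_polarPart {s l : ℕ} (hs : s ≤ l) (m : ℤ) {x : ℝ × ℝ}
    (hx : x.1 ∈ Set.Ioo 0 Real.pi) :
    sY s l m x = Complex.exp (Complex.I * m * x.2) * (-1) ^ (max (-m) 0) *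
      ((alm l m / √(((l + s).factorial : ℝ) * ((l - s).factorial : ℝ)) : ℝ) : ℂ) *
        (polarPart s l m x.1 : ℂ) := by
  have hS : (Real.sin (x.1 / 2) : ℂ) ≠ 0 := mod_cast (sin_half_pos hx).ne'
  have h1 : ((l : ℤ) + s).toNat = l + s := by omega
  have h2 : ((l : ℤ) - s).toNat = l - s := by omega
  have h3 : (l : ℤ) - s = (l - s : ℕ) := by omega
  have h4 : Finset.Icc (0 : ℤ) ((l - s : ℕ) : ℤ) =
      (Finset.range (l - s + 1)).map Nat.castEmbedding := by
    ext r
    simp only [Finset.mem_Icc, Finset.mem_map, Finset.mem_range, Nat.castEmbedding_apply]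
    exact ⟨fun h => ⟨r.toNat, by omega, by omega⟩, by rintro ⟨a, ha, rfl⟩; omega⟩
  rw [sY, h1, h2, mul_assoc _ ((Real.sin (x.1 / 2) : ℂ) ^ _), h3, h4, Finset.sum_map, polarPart]
  congr 1
  rw [Complex.ofReal_sum, Finset.mul_sum]
  refine Finset.sum_congr rfl fun r _ => ?_
  push_cast [Nat.castEmbedding_apply, izbinom_natCast]
  push_cast at hS
  rw [div_zpow, zpow_sub₀ hS (2 * (l : ℤ))]
  ring

lemma hasDerivAt_polar_term (s l r m : ℤ) {t : ℝ} (ht : t ∈ Set.Ioo 0 Real.pi) :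
    HasDerivAt (fun t => Real.cos (t / 2) ^ (2 * r + s - m) *
        Real.sin (t / 2) ^ (2 * l - (2 * r + s - m)))
      ((s * Real.cos t + m) / Real.sin t * (Real.cos (t / 2) ^ (2 * r + s - m) *
          Real.sin (t / 2) ^ (2 * l - (2 * r + s - m))) +
        ((l - r - s) * (Real.cos (t / 2) ^ (2 * r + (s + 1) - m) *
          Real.sin (t / 2) ^ (2 * l - (2 * r + (s + 1) - m))) -
        r * (Real.cos (t / 2) ^ (2 * (r - 1) + (s + 1) - m) *
          Real.sin (t / 2) ^ (2 * l - (2 * (r - 1) + (s + 1) - m))))) t := by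
  have hS := (sin_half_pos ht).ne'
  have hC := (cos_half_pos ht).ne'
  have hhalf : HasDerivAt (fun t : ℝ => t / 2) (1 / 2) t := (hasDerivAt_id t).div_const 2
  have hc := (hasDerivAt_zpow (2 * r + s - m) _ (Or.inl hC)).comp t hhalf.cos
  have hs := (hasDerivAt_zpow (2 * l - (2 * r + s - m)) _ (Or.inl hS)).comp t hhalf.sin
  refine (hc.mul hs).congr_deriv ?_
  have hsin : Real.sin t = 2 * Real.sin (t / 2) * Real.cos (t / 2) := by
    rw [← Real.sin_two_mul]; ring_nf
  have hcos : Real.cos t = Real.cos (t / 2) ^ 2 - Real.sin (t / 2) ^ 2 := by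
    rw [← Real.cos_two_mul']; ring_nf
  have hone := Real.sin_sq_add_cos_sq (t / 2)
  simp only [Function.comp_apply]
  rw [hsin, hcos]
  generalize Real.sin (t / 2) = S at *
  generalize Real.cos (t / 2) = C at *
  rw [show 2 * r + (s + 1) - m = (2 * r + s - m) + 1 by ring,
    show 2 * l - (2 * r + s - m + 1) = 2 * l - (2 * r + s - m) - 1 by ring,
    show 2 * (r - 1) + (s + 1) - m = (2 * r + s - m) - 1 by ring,
    show 2 * l - (2 * r + s - m - 1) = 2 * l - (2 * r + s - m) + 1 by ring]
  simp only [zpow_add_one₀ hC, zpow_sub_one₀ hC, zpow_add_one₀ hS, zpow_sub_one₀ hS]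
  have hm : (m : ℝ) = m * (S ^ 2 + C ^ 2) := by rw [hone, mul_one]
  rw [show (s * (C ^ 2 - S ^ 2) + m : ℝ) = s * (C ^ 2 - S ^ 2) + m * (S ^ 2 + C ^ 2) by
    rw [← hm]]
  push_cast
  generalize C ^ (2 * r + s - m) = P
  generalize S ^ (2 * l - (2 * r + s - m)) = Q
  field_simp
  ring

/-- The ladder relation for the polar parts. -/
lemma hasDerivAt_polarPart {s l : ℕ} (hs : s < l) (m : ℤ) {t : ℝ}
    (ht : t ∈ Set.Ioo 0 Real.pi) :
    HasDerivAt (polarPart s l m)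
      ((s * Real.cos t + m) / Real.sin t * polarPart s l m t -
        (l - s) * polarPart (s + 1) l m t) t := by
  have hsum := HasDerivAt.fun_sum (u := Finset.range (l - s + 1)) fun r _ =>
    (hasDerivAt_polar_term s l r m ht).const_mul
      (((l - s).choose r : ℝ) * (izbinom (l + s) (r + s - m) : ℝ) * (-1) ^ ((l : ℤ) - r - s))
  refine hsum.congr_deriv ?_
  obtain ⟨k, rfl⟩ : ∃ k, l = s + k + 1 := ⟨l - s - 1, by omega⟩
  have h1 : s + k + 1 - s = k + 1 := by omega
  have h2 : s + k + 1 - (s + 1) = k := by omega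
  have hdist (a b c d : ℝ) : a * (b + (c - d)) = a * b + (a * c - a * d) := by ring
  simp only [polarPart, h1, h2, hdist, Finset.sum_add_distrib, Finset.sum_sub_distrib]
  rw [Finset.mul_sum, Finset.mul_sum, sub_eq_add_neg]
  congr 1
  · exact Finset.sum_congr rfl fun r _ => by push_cast; ring
  rw [Finset.sum_range_succ, Finset.sum_range_succ' _ (k + 1)]
  have hz : (((s + k + 1 : ℕ) : ℤ) : ℝ) - ((k + 1 : ℕ) : ℤ) - ((s : ℤ) : ℝ) = 0 := by
    push_cast; ring
  rw [hz]
  simp only [Nat.cast_zero, Int.cast_zero, zero_mul, mul_zero, add_zero]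
  rw [← sub_eq_add_neg, ← Finset.sum_sub_distrib, ← Finset.sum_neg_distrib]
  refine Finset.sum_congr rfl fun r hr => ?_
  have hr' : r ≤ k := by simpa [Nat.lt_succ_iff] using hr
  have hpascal := izbinom_succ_succ (n := (s + k + 1 : ℕ) + s) (by positivity) (r + s - m)
  have hc1 : ((k + 1).choose r : ℝ) * (k + 1 - r) = (k + 1) * k.choose r := by
    have := Nat.choose_mul_succ_eq k r
    have h := congrArg (Nat.cast (R := ℝ)) this
    push_cast [Nat.cast_sub (show r ≤ k + 1 by omega)] at h
    linarith
  have hc2 : ((k + 1).choose (r + 1) : ℝ) * (r + 1) = (k + 1) * k.choose r :=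
    mod_cast (Nat.add_one_mul_choose_eq k r).symm
  have hb1 : ((s + k + 1 : ℕ) : ℤ) + ((s + 1 : ℕ) : ℤ) = ((s + k + 1 : ℕ) : ℤ) + s + 1 := by
    push_cast; ring
  have hb2 : (r : ℤ) + ((s + 1 : ℕ) : ℤ) - m = r + s - m + 1 := by push_cast; ring
  have hb3 : ((r + 1 : ℕ) : ℤ) + s - m = r + s - m + 1 := by push_cast; ring
  have he1 : (-1 : ℝ) ^ (((s + k + 1 : ℕ) : ℤ) - r - s) =
      -(-1) ^ (((s + k + 1 : ℕ) : ℤ) - r - (s + 1 : ℕ)) := by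
    rw [show ((s + k + 1 : ℕ) : ℤ) - r - s =
      ((s + k + 1 : ℕ) : ℤ) - r - (s + 1 : ℕ) + 1 by push_cast; ring,
      zpow_add_one₀ (by norm_num)]
    ring
  have he2 : ((s + k + 1 : ℕ) : ℤ) - (r + 1 : ℕ) - s =
      ((s + k + 1 : ℕ) : ℤ) - r - (s + 1 : ℕ) := by push_cast; ring
  have hp : ((r + 1 : ℕ) : ℤ) - 1 = r := by push_cast; ring
  have hs1 : ((s + 1 : ℕ) : ℤ) = (s : ℤ) + 1 := by push_cast; ring
  rw [hb1, hb2, hb3, he1, he2, hpascal, hp, hs1]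
  generalize (-1 : ℝ) ^ (((s + k + 1 : ℕ) : ℤ) - r - ((s : ℤ) + 1)) = e
  generalize Real.cos (t / 2) ^ (2 * (r : ℤ) + (s + 1) - m) *
    Real.sin (t / 2) ^ (2 * ((s + k + 1 : ℕ) : ℤ) - (2 * r + (s + 1) - m)) = w
  push_cast
  generalize (izbinom _ (r + s - m) : ℝ) = u
  generalize (izbinom _ (r + s - m + 1) : ℝ) = v
  linear_combination (-(u * e * w)) * hc1 - (v * e * w) * hc2

lemma eth_eq_of_hasDerivAt {s : ℤ} {h : ℝ × ℝ → ℂ} {x : ℝ × ℝ} {a b : ℂ}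
    (hx : Real.sin x.1 ≠ 0) (ha : HasDerivAt (fun t => h (t, x.2)) a x.1)
    (hb : HasDerivAt (fun t => h (x.1, t)) b x.2) :
    eth s h x = s * Real.cos x.1 / Real.sin x.1 * h x - a - Complex.I / Real.sin x.1 * b := by
  have hx' : (Real.sin x.1 : ℂ) ≠ 0 := mod_cast hx
  have hsin : HasDerivAt (fun t : ℝ => (Real.sin t : ℂ) ^ (-s))
      (((-s : ℤ) : ℂ) * (Real.sin x.1 : ℂ) ^ (-s - 1) * Real.cos x.1) x.1 :=
    HasDerivAt.comp (h₂ := fun z : ℂ => z ^ (-s)) x.1 (hasDerivAt_zpow (-s) _ (Or.inl hx'))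
      (Real.hasDerivAt_sin x.1).ofReal_comp
  have hθ : pdθ (fun y => (Real.sin y.1 : ℂ) ^ (-s) * h y) x = _ := (hsin.mul ha).deriv
  have hφ : pdφ (fun y => (Real.sin y.1 : ℂ) ^ (-s) * h y) x = _ :=
    (hb.const_mul ((Real.sin x.1 : ℂ) ^ (-s))).deriv
  rw [eth, hθ, hφ, zpow_sub_one₀ hx', zpow_neg]
  have hz : (Real.sin x.1 : ℂ) ^ s ≠ 0 := zpow_ne_zero _ hx'
  push_cast at hx' hz ⊢
  field_simp
  ring

/-- `ð_s` maps `ₛY_{lm}` to `√((l-s)(l+s+1)) ₛ₊₁Y_{lm}`, for linear combinations given on the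
strip `(0,π) × ℝ`. -/
lemma eth_sum_sY {s l : ℕ} (hs : s < l) {A : Finset ℤ} (c : ℤ → ℂ) {h : ℝ × ℝ → ℂ}
    (hh : ∀ x : ℝ × ℝ, x.1 ∈ Set.Ioo 0 Real.pi → h x = ∑ m ∈ A, c m * sY s l m x)
    {x : ℝ × ℝ} (hx : x.1 ∈ Set.Ioo 0 Real.pi) :
    eth s h x = (√(((l : ℝ) - s) * (l + s + 1)) : ℂ) * ∑ m ∈ A, c m * sY (s + 1 : ℕ) l m x := by
  have hsin := (Real.sin_pos_of_mem_Ioo hx).ne'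
  set E : ℤ → ℝ → ℂ := fun m φ => Complex.exp (Complex.I * m * φ) with hE
  set K : ℕ → ℤ → ℂ := fun s m => (-1) ^ (max (-m) 0) *
    ((alm l m / √(((l + s).factorial : ℝ) * ((l - s).factorial : ℝ)) : ℝ) : ℂ) with hK
  have hY (n : ℕ) (hn : n ≤ l) (m : ℤ) (y : ℝ × ℝ) (hy : y.1 ∈ Set.Ioo 0 Real.pi) :
      sY n l m y = E m y.2 * K n m * (polarPart n l m y.1 : ℂ) := by
    rw [sY_eq_polarPart hn m hy, hE, hK]; ring
  have ha : HasDerivAt (fun t => h (t, x.2)) (∑ m ∈ A, c m * (E m x.2 * K s m *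
      (((s * Real.cos x.1 + m) / Real.sin x.1 * polarPart s l m x.1 -
        (l - s) * polarPart (s + 1) l m x.1 : ℝ) : ℂ))) x.1 := by
    refine (HasDerivAt.fun_sum fun m _ =>
      (((hasDerivAt_polarPart hs m hx).ofReal_comp.const_mul
        (E m x.2 * K s m)).const_mul (c m))).congr_of_eventuallyEq ?_
    filter_upwards [isOpen_Ioo.mem_nhds hx] with t ht
    rw [hh _ ht]
    exact Finset.sum_congr rfl fun m _ => by rw [hY s hs.le m _ ht]
  have hexp (m : ℤ) : HasDerivAt (E m) (E m x.2 * (Complex.I * m)) x.2 := by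
    have h1 : HasDerivAt (fun t : ℝ => Complex.I * m * (t : ℂ)) (Complex.I * m) x.2 := by
      simpa using (Complex.ofRealCLM.hasDerivAt (x := x.2)).const_mul (Complex.I * (m : ℂ))
    exact h1.cexp
  have hb : HasDerivAt (fun t => h (x.1, t)) (∑ m ∈ A, c m * (E m x.2 * (Complex.I * m) * K s m *
      (polarPart s l m x.1 : ℂ))) x.2 := by
    have heq : (fun t => h (x.1, t)) =
        fun t => ∑ m ∈ A, c m * (E m t * K s m * (polarPart s l m x.1 : ℂ)) := by
      funext t
      rw [hh (x.1, t) hx]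
      exact Finset.sum_congr rfl fun m _ => by rw [hY s hs.le m (x.1, t) hx]
    rw [heq]
    exact HasDerivAt.fun_sum fun m _ =>
      (((hexp m).mul_const (K s m)).mul_const (polarPart s l m x.1 : ℂ)).const_mul (c m)
  have hKsucc (m : ℤ) : (√(((l : ℝ) - s) * (l + s + 1)) : ℂ) * K (s + 1) m =
      ((l : ℂ) - s) * K s m := by
    obtain ⟨k, rfl⟩ : ∃ k, l = s + k + 1 := ⟨l - s - 1, by omega⟩
    have h1 : s + k + 1 - s = k + 1 := by omega
    have h2 : s + k + 1 - (s + 1) = k := by omega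
    have hreal : √((((s + k + 1 : ℕ) : ℝ) - s) * ((s + k + 1 : ℕ) + s + 1)) *
        (alm (s + k + 1 : ℕ) m /
          √(((s + k + 1 + (s + 1)).factorial : ℝ) * (k.factorial : ℝ))) =
        (((s + k + 1 : ℕ) : ℝ) - s) * (alm (s + k + 1 : ℕ) m /
          √(((s + k + 1 + s).factorial : ℝ) * ((k + 1).factorial : ℝ))) := by
      have e1 : ((s + k + 1 : ℕ) : ℝ) - s = k + 1 := by push_cast; ring
      have e2 : ((s + k + 1 + (s + 1)).factorial : ℝ) =
          ((s + k + 1 : ℕ) + s + 1) * (s + k + 1 + s).factorial := by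
        rw [← add_assoc, Nat.factorial_succ]; push_cast; ring
      have e3 : ((k + 1).factorial : ℝ) = (k + 1) * k.factorial := by
        rw [Nat.factorial_succ]; push_cast; ring
      rw [e1, e2, e3]
      have p1 : 0 < (k : ℝ) + 1 := by positivity
      have p2 : 0 < ((s + k + 1 : ℕ) : ℝ) + s + 1 := by positivity
      have p3 : 0 < ((s + k + 1 + s).factorial : ℝ) := by positivity
      have p4 : 0 < (k.factorial : ℝ) := by positivity
      generalize ((s + k + 1 : ℕ) : ℝ) + s + 1 = b at *
      generalize (k : ℝ) + 1 = a at *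
      generalize ((s + k + 1 + s).factorial : ℝ) = f at *
      generalize (k.factorial : ℝ) = g at *
      rw [Real.sqrt_mul p1.le, mul_assoc b, Real.sqrt_mul p2.le, mul_left_comm f,
        Real.sqrt_mul p1.le]
      have := Real.sqrt_pos.mpr p1
      have := Real.sqrt_pos.mpr p2
      have := Real.sqrt_pos.mpr (mul_pos p3 p4)
      field_simp
      rw [Real.sq_sqrt p1.le, mul_comm]
    have hc := congrArg (fun z : ℝ => (z : ℂ)) hreal
    simp only [hK, h1, h2]
    push_cast at hc ⊢
    linear_combination (-1 : ℂ) ^ (max (-m) 0) * hc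
  rw [eth_eq_of_hasDerivAt hsin ha hb, hh x hx]
  simp only [Finset.mul_sum]
  rw [← Finset.sum_sub_distrib, ← Finset.sum_sub_distrib]
  refine Finset.sum_congr rfl fun m _ => ?_
  rw [hY s hs.le m x hx, hY (s + 1) hs m x hx]
  have hsin' : (Real.sin x.1 : ℂ) ≠ 0 := mod_cast hsin
  push_cast at hsin' ⊢
  have hI := Complex.I_mul_I
  field_simp
  linear_combination (-(c m * E m x.2 * K s m * m * polarPart s l m x.1)) * hI -
    (c m * E m x.2 * polarPart (s + 1) l m x.1 * Complex.sin x.1) * hKsucc m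

lemma ethIter_sum_sY {n l : ℕ} (hn : n ≤ l) {A : Finset ℤ} (c : ℤ → ℂ) {h : ℝ × ℝ → ℂ}
    (hh : ∀ x : ℝ × ℝ, x.1 ∈ Set.Ioo 0 Real.pi → h x = ∑ m ∈ A, c m * sY 0 l m x) :
    ∀ x : ℝ × ℝ, x.1 ∈ Set.Ioo 0 Real.pi → ethIter n h x =
      (√((l + n).factorial / (l - n).factorial : ℝ) : ℂ) * ∑ m ∈ A, c m * sY n l m x := by
  induction n with
  | zero =>
    intro x hx
    have : (l.factorial : ℝ) ≠ 0 := by positivity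
    simp [ethIter, hh x hx, this]
  | succ n ih =>
    intro x hx
    set κ : ℂ := (√((l + n).factorial / (l - n).factorial : ℝ) : ℂ) with hκ
    have hstep := eth_sum_sY (s := n) (A := A) hn (fun m => κ * c m) (h := ethIter n h)
      (fun y hy => by rw [ih (by omega) y hy, Finset.mul_sum]; simp only [mul_assoc]) hx
    rw [ethIter, hstep]
    simp only [mul_assoc]
    rw [← Finset.mul_sum, ← mul_assoc]
    congr 1
    rw [hκ, ← Complex.ofReal_mul]
    obtain ⟨k, rfl⟩ : ∃ k, l = n + k + 1 := ⟨l - n - 1, by omega⟩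
    have h1 : n + k + 1 - n = k + 1 := by omega
    have h2 : n + k + 1 - (n + 1) = k := by omega
    have hpos : (0 : ℝ) ≤ (((n + k + 1 : ℕ) : ℝ) - n) * ((n + k + 1 : ℕ) + n + 1) := by
      push_cast
      have : (n : ℝ) + k + 1 - n = k + 1 := by ring
      rw [this]; positivity
    rw [← Real.sqrt_mul hpos, h1, h2, ← add_assoc, Nat.factorial_succ (n + k + 1 + n),
      Nat.factorial_succ k]
    congr 2
    push_cast
    have : (k : ℝ) + 1 ≠ 0 := by positivity
    field_simp
    ring

/-- **The spin-`s` reproducing kernel from the scalar one by raising in `x` and conjugate-raising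
in `y`** (Statement 11). -/
theorem spin_kernel_from_scalar (s l : ℤ) (hs : 0 < s) (hl : s ≤ l) :
    ∀ x y : ℝ × ℝ, x.1 ∈ Set.Ioo 0 Real.pi → y.1 ∈ Set.Ioo 0 Real.pi →
      ∑ m ∈ Finset.Icc (-l) l, sY s l m x * (starRingEnd ℂ) (sY s l m y) =
        (((l - s).toNat.factorial : ℂ) / ((l + s).toNat.factorial : ℂ)) *
          ethIter s.toNat (fun x' =>
            ethbarIterConj s.toNat (fun y' =>
              ∑ m ∈ Finset.Icc (-l) l, sY 0 l m x' * (starRingEnd ℂ) (sY 0 l m y')) y) x := by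
  intro x y hx hy
  lift s to ℕ using hs.le
  lift l to ℕ using hs.le.trans hl
  have hsl : s ≤ l := by omega
  have h1 : ((l : ℤ) + s).toNat = l + s := by omega
  have h2 : ((l : ℤ) - s).toNat = l - s := by omega
  rw [Int.toNat_natCast, h1, h2]
  set κ : ℝ := √((l + s).factorial / (l - s).factorial : ℝ) with hκ
  have hinner (x' : ℝ × ℝ) : ethbarIterConj s (fun y' =>
      ∑ m ∈ Finset.Icc (-(l : ℤ)) l, sY 0 l m x' * (starRingEnd ℂ) (sY 0 l m y')) y =
      ∑ m ∈ Finset.Icc (-(l : ℤ)) l, (κ * (starRingEnd ℂ) (sY s l m y)) * sY 0 l m x' := by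
    rw [ethbarIterConj, ethIter_sum_sY hsl (A := Finset.Icc (-(l : ℤ)) l)
      (fun m => (starRingEnd ℂ) (sY 0 l m x')) (fun z _ => by simp [map_sum]) y hy]
    rw [map_mul, map_sum, Complex.conj_ofReal, Finset.mul_sum]
    refine Finset.sum_congr rfl fun m _ => ?_
    rw [map_mul, Complex.conj_conj]
    ring
  rw [ethIter_sum_sY hsl _ (fun z _ => hinner z) x hx, ← hκ]
  have hκ2 : (κ : ℂ) * κ = (l + s).factorial / (l - s).factorial := by
    rw [← Complex.ofReal_mul, Real.mul_self_sqrt (by positivity)]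
    push_cast
    rfl
  have p1 : ((l + s).factorial : ℂ) ≠ 0 := mod_cast (l + s).factorial_ne_zero
  have p2 : ((l - s).factorial : ℂ) ≠ 0 := mod_cast (l - s).factorial_ne_zero
  have hone : ((l - s).factorial : ℂ) / (l + s).factorial * (κ * κ) = 1 := by
    rw [hκ2]; field_simp
  rw [Finset.mul_sum, Finset.mul_sum]
  refine Finset.sum_congr rfl fun m _ => ?_
  linear_combination (-(sY s l m x * (starRingEnd ℂ) (sY s l m y))) * hone
end
end
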